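/- arXiv:1405.5400 — 2 statements merged into one kernel-verified Lean document; each statement's English description precedes it below -/
import Mathlib

section
/- Let X be a geodesic metric space and δ' ≥ 0 such that for every n ≥ 2 and all points x₀, x₁, …, xₙ, p ∈ X one has (x₀|xₙ)_p ≥ min{(x₀|x₁)_p, …, (xₙ₋₁|xₙ)_p} − δ'. Then every geodesic polygon in X is 3δ'-thin. -/
/-- `ξ` is a geodesic defined on the interval `[0, s]`. -/
def IsGeodesicOn {X : Type*} [MetricSpace X] (ξ : ℝ → X) (s : ℝ) : Prop :=
  0 ≤ s ∧ ∀ a ∈ Set.Icc (0:ℝ) s, ∀ b ∈ Set.Icc (0:ℝ) s, dist (ξ a) (ξ b) = |a - b|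

/-- `X` is a geodesic metric space: any two points are joined by a geodesic. -/
def IsGeodesicSpace (X : Type*) [MetricSpace X] : Prop :=
  ∀ x y : X, ∃ (s : ℝ) (ξ : ℝ → X), IsGeodesicOn ξ s ∧ ξ 0 = x ∧ ξ s = y
/-- A geodesic polygon `[[ξ₀, …, ξₙ]]` (an `(n+1)`-gon, `n ≥ 1`): a closed cycle of
`n + 1` geodesics. -/
structure GeodesicPolygon (X : Type*) [MetricSpace X] where
  n : ℕ
  one_le_n : 1 ≤ n
  s : ℕ → ℝ
  ξ : ℕ → ℝ → X
  geodesic : ∀ i ≤ n, IsGeodesicOn (ξ i) (s i)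
  chain : ∀ i < n, ξ i (s i) = ξ (i + 1) 0
  closed : ξ n (s n) = ξ 0 0

/-- The polygon is `δ`-thin: the image of the last side `ξₙ` is contained in the closed
`δ`-neighbourhood of the union of the images of `ξ₀, …, ξₙ₋₁`. -/
def GeodesicPolygon.Thin {X : Type*} [MetricSpace X] (P : GeodesicPolygon X) (δ : ℝ) : Prop :=
  ∀ t ∈ Set.Icc (0:ℝ) (P.s P.n), ∃ j < P.n, ∃ u ∈ Set.Icc (0:ℝ) (P.s j),
    dist (P.ξ P.n t) (P.ξ j u) ≤ δ

/-- `X` is polygon hyperbolic if some `δ ≥ 0` makes every geodesic polygon `δ`-thin. -/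
def PolygonHyperbolic (X : Type*) [MetricSpace X] : Prop :=
  ∃ δ : ℝ, 0 ≤ δ ∧ ∀ P : GeodesicPolygon X, P.Thin δ
/-- The Gromov product `(x|y)_p = ½(d(p,x) + d(p,y) − d(x,y))`. -/
noncomputable def gromovProd {X : Type*} [MetricSpace X] (p x y : X) : ℝ :=
  (dist p x + dist p y - dist x y) / 2

/-- The Gromov product of the endpoints of a geodesic vanishes at every point of the geodesic. -/
lemma IsGeodesicOn.gromovProd_eq_zero {X : Type*} [MetricSpace X] {ξ : ℝ → X} {s t : ℝ}
    (h : IsGeodesicOn ξ s) (ht : t ∈ Set.Icc (0:ℝ) s) :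
    gromovProd (ξ t) (ξ s) (ξ 0) = 0 := by
  obtain ⟨hs, hd⟩ := h
  have h0 : (0:ℝ) ∈ Set.Icc (0:ℝ) s := ⟨le_rfl, hs⟩
  have h1 : s ∈ Set.Icc (0:ℝ) s := ⟨hs, le_rfl⟩
  rw [gromovProd, hd t ht s h1, hd t ht 0 h0, hd s h1 0 h0, abs_of_nonpos (by linarith [ht.2]),
    abs_of_nonneg (by linarith [ht.1]), abs_of_nonneg (by linarith)]
  ring

/-- If the four-point inequality with constant `δ` holds, the distance from `p` to a geodesic
exceeds the Gromov product of its endpoints at `p` by at most `2δ`. -/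
lemma IsGeodesicOn.exists_dist_le_gromovProd_add {X : Type*} [MetricSpace X] {δ : ℝ}
    (hX : ∀ p x y z : X, min (gromovProd p x y) (gromovProd p y z) - δ ≤ gromovProd p x z)
    {ξ : ℝ → X} {s : ℝ} (h : IsGeodesicOn ξ s) (p : X) :
    ∃ u ∈ Set.Icc (0:ℝ) s, dist p (ξ u) ≤ gromovProd p (ξ 0) (ξ s) + 2 * δ := by
  obtain ⟨hs, hd⟩ := h
  have h0 : (0:ℝ) ∈ Set.Icc (0:ℝ) s := ⟨le_rfl, hs⟩
  have h1 : s ∈ Set.Icc (0:ℝ) s := ⟨hs, le_rfl⟩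
  have hxy : dist (ξ 0) (ξ s) = s := by rw [hd 0 h0 s h1]; simp [abs_of_nonneg hs]
  have t1 := dist_triangle p (ξ 0) (ξ s)
  rw [hxy] at t1
  have t2 : dist p (ξ 0) ≤ dist p (ξ s) + s := by
    simpa [dist_comm (ξ s), hxy] using dist_triangle p (ξ s) (ξ 0)
  set u := (s + dist p (ξ 0) - dist p (ξ s)) / 2 with hu
  have hu_mem : u ∈ Set.Icc (0:ℝ) s := ⟨by linarith, by linarith⟩
  have d1 : dist (ξ 0) (ξ u) = u := by rw [hd 0 h0 u hu_mem]; simp [abs_of_nonneg hu_mem.1]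
  have d2 : dist (ξ u) (ξ s) = s - u := by
    rw [hd u hu_mem s h1, abs_of_nonpos (by linarith [hu_mem.2])]; ring
  refine ⟨u, hu_mem, ?_⟩
  have key := hX p (ξ 0) (ξ u) (ξ s)
  simp only [gromovProd, d1, d2, hxy] at key ⊢
  rcases min_choice ((dist p (ξ 0) + dist p (ξ u) - u) / 2)
    ((dist p (ξ u) + dist p (ξ s) - (s - u)) / 2) with hm | hm <;> rw [hm] at key <;> linarith

/-- If in the geodesic metric space `X` one has
`(x₀|xₙ)_p ≥ min{(x₀|x₁)_p, …, (xₙ₋₁|xₙ)_p} − δ'` for all `n ≥ 2` and all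
`x₀, …, xₙ, p ∈ X`, then every geodesic polygon in `X` is `3δ'`-thin. -/
theorem polygon_thin_of_gromov_inequality {X : Type*} [MetricSpace X]
    (hX : IsGeodesicSpace X) (δ' : ℝ) (hδ' : 0 ≤ δ')
    (hgp : ∀ (n : ℕ), ∀ _hn : 2 ≤ n, ∀ (x : ℕ → X) (p : X),
      ((Finset.range n).inf' (Finset.nonempty_range_iff.mpr (by omega))
          fun i => gromovProd p (x i) (x (i + 1))) - δ'
        ≤ gromovProd p (x 0) (x n)) :
    ∀ P : GeodesicPolygon X, P.Thin (3 * δ') := by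
  intro P t ht
  have hfour (p x y z : X) :
      min (gromovProd p x y) (gromovProd p y z) - δ' ≤ gromovProd p x z := by
    have h := hgp 2 le_rfl (fun i => if i = 0 then x else if i = 1 then y else z) p
    obtain ⟨i, hi, hmin⟩ := Finset.exists_mem_eq_inf' (s := Finset.range 2) ⟨0, by simp⟩
      fun i => gromovProd p ((fun i => if i = 0 then x else if i = 1 then y else z) i)
        ((fun i => if i = 0 then x else if i = 1 then y else z) (i + 1))
    rw [hmin] at h
    rw [Finset.mem_range] at hi
    interval_cases i
    · exact (sub_le_sub_right (min_le_left _ _) _).trans (by simpa using h)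
    · exact (sub_le_sub_right (min_le_right _ _) _).trans (by simpa using h)
  have hzero := (P.geodesic P.n le_rfl).gromovProd_eq_zero ht
  rw [P.closed] at hzero
  set p := P.ξ P.n t
  obtain ⟨j, hj, hprod⟩ : ∃ j < P.n, gromovProd p (P.ξ j 0) (P.ξ (j + 1) 0) ≤ δ' := by
    rcases P.one_le_n.eq_or_lt with h1 | h2
    · exact ⟨0, P.one_le_n, by rw [zero_add, h1, hzero]; exact hδ'⟩
    · have h := hgp P.n h2 (fun i => P.ξ i 0) p
      obtain ⟨j, hj, hmin⟩ := Finset.exists_mem_eq_inf' (s := Finset.range P.n)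
        ⟨0, Finset.mem_range.mpr P.one_le_n⟩
        fun i => gromovProd p (P.ξ i 0) (P.ξ (i + 1) 0)
      rw [hmin, hzero] at h
      exact ⟨j, Finset.mem_range.mp hj, by linarith⟩
  obtain ⟨u, hu, hdist⟩ := (P.geodesic j hj.le).exists_dist_le_gromovProd_add hfour p
  rw [P.chain j hj] at hdist
  exact ⟨j, hj, u, hu, by linarith⟩
end

section
/- Let X be a geodesic metric space and suppose there exists ε ≥ 0 such that for every geodesic ξ and every coterminal continuous path ξ' in X, the image of ξ is contained in the closed ε-neighborhood of the image of ξ'. Then mesh(X) is finite. -/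
/-- `ξ` is a (continuous) path defined on the interval `[0, s]`. -/
def IsPathOn {X : Type*} [MetricSpace X] (ξ : ℝ → X) (s : ℝ) : Prop :=
  0 ≤ s ∧ ContinuousOn ξ (Set.Icc (0:ℝ) s)

/-- A triangle `[[ξ₀, ξ₁, ξ₂]]`: a closed cycle of three continuous paths. -/
structure Triangle (X : Type*) [MetricSpace X] where
  s : Fin 3 → ℝ
  ξ : Fin 3 → ℝ → X
  path : ∀ i, IsPathOn (ξ i) (s i)
  chain : ∀ i : Fin 3, ξ i (s i) = ξ (i + 1) 0

/-- The mesh of a triangle: the infimum, over choices of a point on each side, of the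
diameter of the resulting three-point set. -/
noncomputable def Triangle.mesh {X : Type*} [MetricSpace X] (T : Triangle X) : ℝ :=
  sInf { d : ℝ | ∃ u : Fin 3 → ℝ, (∀ i, u i ∈ Set.Icc (0:ℝ) (T.s i)) ∧
    d = Metric.diam (Set.range fun i => T.ξ i (u i)) }

/-- The mesh of the space `X`: the supremum of the meshes of all triangles in `X`
(as an extended nonnegative real, so that it may be `+∞`). -/
noncomputable def meshSpace (X : Type*) [MetricSpace X] : ENNReal :=
  ⨆ T : Triangle X, ENNReal.ofReal T.mesh

theorem IsGeodesicOn.continuousOn {X : Type*} [MetricSpace X] {ξ : ℝ → X} {s : ℝ}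
    (h : IsGeodesicOn ξ s) : ContinuousOn ξ (Set.Icc 0 s) := by
  refine LipschitzOnWith.continuousOn (K := 1) (LipschitzOnWith.of_dist_le_mul ?_)
  intro a ha b hb
  simp [h.2 a ha b hb, Real.dist_eq]

theorem IsPathOn.reverse {X : Type*} [MetricSpace X] {ξ : ℝ → X} {s : ℝ}
    (h : IsPathOn ξ s) : IsPathOn (fun t => ξ (s - t)) s :=
  ⟨h.1, h.2.comp (by fun_prop) fun t ht => ⟨by linarith [ht.2], by linarith [ht.1]⟩⟩

theorem IsPathOn.concat {X : Type*} [MetricSpace X] {ξ η : ℝ → X} {s r : ℝ}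
    (hξ : IsPathOn ξ s) (hη : IsPathOn η r) (hc : ξ s = η 0) :
    IsPathOn (fun t => if t ≤ s then ξ t else η (t - s)) (s + r) := by
  have hs := hξ.1
  have hr := hη.1
  refine ⟨by linarith, ?_⟩
  rw [← Set.Icc_union_Icc_eq_Icc hs (by linarith : s ≤ s + r)]
  refine ContinuousOn.union_of_isClosed ?_ ?_ isClosed_Icc isClosed_Icc
  · exact hξ.2.congr fun t ht => if_pos ht.2
  · have hshift : ContinuousOn (fun t => η (t - s)) (Set.Icc s (s + r)) :=
      hη.2.comp (by fun_prop) fun t ht => ⟨by linarith [ht.1], by linarith [ht.2]⟩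
    refine hshift.congr fun t ht => ?_
    rcases ht.1.eq_or_lt with rfl | hlt
    · simp [hc]
    · simp [hlt.not_ge]

theorem IsPathOn.exists_dist_eq_infDist {X : Type*} [MetricSpace X] {ξ : ℝ → X} {s : ℝ}
    (h : IsPathOn ξ s) (x : X) :
    ∃ u ∈ Set.Icc 0 s, dist x (ξ u) = Metric.infDist x (ξ '' Set.Icc 0 s) := by
  have hne : (ξ '' Set.Icc 0 s).Nonempty := (Set.nonempty_Icc.2 h.1).image ξ
  obtain ⟨_, ⟨u, hu, rfl⟩, hd⟩ :=
    (isCompact_Icc.image_of_continuousOn h.2).exists_infDist_eq_dist hne x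
  exact ⟨u, hu, hd.symm⟩

/-- A continuous path starting near one path and ending near a second one, and staying near
their union, has a point near both. -/
theorem IsPathOn.exists_near_both {X : Type*} [MetricSpace X] {γ ξ η : ℝ → X} {l s r ε : ℝ}
    (hε : 0 ≤ ε) (hγ : IsPathOn γ l) (hξ : IsPathOn ξ s) (hη : IsPathOn η r)
    (h0 : γ 0 ∈ ξ '' Set.Icc 0 s) (hl : γ l ∈ η '' Set.Icc 0 r)
    (hcover : ∀ t ∈ Set.Icc 0 l, (∃ u ∈ Set.Icc 0 s, dist (γ t) (ξ u) ≤ ε) ∨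
      ∃ u ∈ Set.Icc 0 r, dist (γ t) (η u) ≤ ε) :
    ∃ t ∈ Set.Icc 0 l, (∃ u ∈ Set.Icc 0 s, dist (γ t) (ξ u) ≤ ε) ∧
      ∃ u ∈ Set.Icc 0 r, dist (γ t) (η u) ≤ ε := by
  have himage : IsPreconnected (γ '' Set.Icc 0 l) := isPreconnected_Icc.image γ hγ.2
  have hclosed (K : Set X) : IsClosed {x | Metric.infDist x K ≤ ε} :=
    isClosed_le (Metric.continuous_infDist_pt K) continuous_const
  obtain ⟨_, ⟨t, ht, rfl⟩, h1, h2⟩ := isPreconnected_closed_iff.1 himage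
    {x | Metric.infDist x (ξ '' Set.Icc 0 s) ≤ ε} {x | Metric.infDist x (η '' Set.Icc 0 r) ≤ ε}
    (hclosed _) (hclosed _)
    (by
      rintro _ ⟨t, ht, rfl⟩
      refine (hcover t ht).imp ?_ ?_ <;> rintro ⟨u, hu, hd⟩ <;>
        exact (Metric.infDist_le_dist_of_mem (Set.mem_image_of_mem _ hu)).trans hd)
    ⟨γ 0, ⟨0, Set.left_mem_Icc.2 hγ.1, rfl⟩, by
      simpa [Metric.infDist_zero_of_mem h0] using hε⟩
    ⟨γ l, ⟨l, Set.right_mem_Icc.2 hγ.1, rfl⟩, by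
      simpa [Metric.infDist_zero_of_mem hl] using hε⟩
  obtain ⟨u, hu, hud⟩ := hξ.exists_dist_eq_infDist (γ t)
  obtain ⟨v, hv, hvd⟩ := hη.exists_dist_eq_infDist (γ t)
  exact ⟨t, ht, ⟨u, hu, hud.trans_le h1⟩, v, hv, hvd.trans_le h2⟩

theorem Triangle.mesh_le_of_near_point {X : Type*} [MetricSpace X] (T : Triangle X) {ε : ℝ}
    (hε : 0 ≤ ε) (x : X) (h : ∀ i, ∃ u ∈ Set.Icc 0 (T.s i), dist x (T.ξ i u) ≤ ε) :
    T.mesh ≤ 2 * ε := by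
  choose u hu hd using h
  have hbdd : BddBelow { d : ℝ | ∃ u : Fin 3 → ℝ, (∀ i, u i ∈ Set.Icc (0:ℝ) (T.s i)) ∧
      d = Metric.diam (Set.range fun i => T.ξ i (u i)) } := by
    refine ⟨0, ?_⟩
    rintro _ ⟨u, -, rfl⟩
    exact Metric.diam_nonneg
  refine (csInf_le hbdd ⟨u, hu, rfl⟩).trans (Metric.diam_le_of_forall_dist_le (by positivity) ?_)
  rintro _ ⟨i, rfl⟩ _ ⟨j, rfl⟩
  linarith [dist_triangle_left (T.ξ i (u i)) (T.ξ j (u j)) x, hd i, hd j]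

/-- If there exists `ε ≥ 0` such that in the geodesic metric space `X` every geodesic
lies in the closed `ε`-neighbourhood of any coterminal continuous path, then `mesh(X)`
is finite. -/
theorem meshSpace_ne_top_of_geodesic_near_paths {X : Type*} [MetricSpace X]
    (hX : IsGeodesicSpace X)
    (h : ∃ ε : ℝ, 0 ≤ ε ∧ ∀ (s s' : ℝ) (ξ ξ' : ℝ → X),
      IsGeodesicOn ξ s → IsPathOn ξ' s' → ξ' 0 = ξ 0 → ξ' s' = ξ s →
      ∀ t ∈ Set.Icc (0:ℝ) s, ∃ u ∈ Set.Icc (0:ℝ) s', dist (ξ t) (ξ' u) ≤ ε) :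
    meshSpace X ≠ ⊤ := by
  obtain ⟨ε, hε, hnear⟩ := h
  refine ne_top_of_le_ne_top (ENNReal.ofReal_ne_top (r := 2 * ε))
    (iSup_le fun T => ENNReal.ofReal_le_ofReal ?_)
  have c0 : T.ξ 0 (T.s 0) = T.ξ 1 0 := T.chain 0
  have c1 : T.ξ 1 (T.s 1) = T.ξ 2 0 := T.chain 1
  have c2 : T.ξ 2 (T.s 2) = T.ξ 0 0 := T.chain 2
  have n1 := (T.path 1).1
  have n2 := (T.path 2).1
  obtain ⟨l, γ, hγ, hγ0, hγl⟩ := hX (T.ξ 0 0) (T.ξ 0 (T.s 0))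
  have hη := (T.path 2).reverse.concat (T.path 1).reverse (by simp [c1])
  have hcover := hnear l _ γ _ hγ hη (by simp [n2, c2, hγ0]) (by
    rcases n1.eq_or_lt with h1 | h1
    · simp [← h1, hγl, c0, ← c1]
    · simp [h1, hγl, c0])
  obtain ⟨t, ht, hd2, hd1⟩ := IsPathOn.exists_near_both hε ⟨hγ.1, hγ.continuousOn⟩
    (T.path 2) (T.path 1) ⟨T.s 2, Set.right_mem_Icc.2 n2, c2.trans hγ0.symm⟩
    ⟨0, Set.left_mem_Icc.2 n1, c0.symm.trans hγl.symm⟩ fun t ht => by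
      obtain ⟨u, hu, hd⟩ := hcover t ht
      split_ifs at hd with hus
      · exact .inl ⟨_, ⟨by linarith, by linarith [hu.1]⟩, hd⟩
      · exact .inr ⟨_, ⟨by linarith [hu.2], by linarith⟩, hd⟩
  refine T.mesh_le_of_near_point hε (γ t) fun i => ?_
  fin_cases i
  · exact hnear l _ γ _ hγ (T.path 0) hγ0.symm hγl.symm t ht
  · exact hd1
  · exact hd2
end
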